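/- Let p > 3 be a prime. If p ≡ 1 (mod 3), then the restriction to B of the permutation ℤ[G]-module ℤ[G/C₆] is isomorphic as a ℤ[B]-module to ℤ[B/(s₁C₆s₁⁻¹ ∩ B)] ⊕ ℤ[B/(s₂C₆s₂⁻¹ ∩ B)] ⊕ (ℤ[B/C₂])^{(p-1)/3}, where s₁ = (1 0; x₁ 1) and s₂ = (1 0; x₂ 1) with x₁, x₂ the two distinct roots of t² - t + 1 in F_p (and in this case sᵢC₆sᵢ⁻¹ ⊆ B). If p ≢ 1 (mod 3), then ℤ[G/C₆] restricted to B is isomorphic to (ℤ[B/C₂])^{(p+1)/3}. -/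

import Mathlib

open CategoryTheory Limits

attribute [local instance] Abelian.hasFiniteBiproducts

namespace AdemNaffah

variable (p : ℕ)

/-- The Borel subgroup of `SL₂(𝔽_p)`: matrices with lower-left entry `0`. -/
def BorelSL2 : Subgroup (Matrix.SpecialLinearGroup (Fin 2) (ZMod p)) where
  carrier := {g | (g : Matrix (Fin 2) (Fin 2) (ZMod p)) 1 0 = 0}
  one_mem' := by simp
  mul_mem' := by
    intro a b ha hb
    simp only [Set.mem_setOf_eq] at *
    rw [Matrix.SpecialLinearGroup.coe_mul, Matrix.mul_apply]
    simp [Fin.sum_univ_two, ha, hb]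
  inv_mem' := by
    intro a ha
    simp only [Set.mem_setOf_eq] at *
    rw [Matrix.SpecialLinearGroup.SL2_inv_expl]
    simp [ha]

/-- The unipotent lower-triangular matrix `(1 0; x 1)` in `SL₂(𝔽_p)`. -/
def unip (x : ZMod p) : Matrix.SpecialLinearGroup (Fin 2) (ZMod p) :=
  ⟨!![1, 0; x, 1], by simp [Matrix.det_fin_two_of]⟩

/-- The central element `a₂ = -I` of order 2. -/
def a2 : Matrix.SpecialLinearGroup (Fin 2) (ZMod p) :=
  ⟨!![-1, 0; 0, -1], by simp [Matrix.det_fin_two_of]⟩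

/-- The element `a₆ = (0 -1; 1 1)` of order 6. -/
def a6 : Matrix.SpecialLinearGroup (Fin 2) (ZMod p) :=
  ⟨!![0, -1; 1, 1], by simp [Matrix.det_fin_two_of]⟩

section RepLemmas

variable {k : Type} [CommRing k] {K : Type} [Group K]

/-- The basis vector of the permutation module attached to a point. -/
noncomputable def pt (k : Type) [CommRing k] (K : Type) [Group K] {X : Type} [MulAction K X]
    (x : X) : Rep.ofMulAction k K X :=
  (MonoidAlgebra.single x 1 : MonoidAlgebra k X)

/-- Linear extension of an equivariant map to a morphism out of a permutation module. -/
noncomputable def permLift {X : Type} [MulAction K X] (A : Rep.{0} k K) (φ : X → A)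
    (hφ : ∀ (g : K) (x : X), φ (g • x) = A.ρ g (φ x)) : Rep.ofMulAction k K X ⟶ A :=
  Rep.ofHom (σ := A.ρ) ⟨Finsupp.lift A k X φ ∘ₗ (MonoidAlgebra.coeffLinearEquiv _).toLinearMap, by
    intro g
    ext x
    simp [hφ]⟩

theorem permLift_single {X : Type} [MulAction K X] (A : Rep.{0} k K) (φ : X → A)
    (hφ : ∀ (g : K) (x : X), φ (g • x) = A.ρ g (φ x)) (x : X) :
    (permLift A φ hφ).hom (pt k K x) = φ x := by
  simp [permLift, pt]

theorem perm_hom_ext {X : Type} [MulAction K X] {A : Rep.{0} k K}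
    {f g : Rep.ofMulAction k K X ⟶ A}
    (h : ∀ x : X, f.hom (pt k K x) = g.hom (pt k K x)) :
    f = g := by
  apply Rep.hom_ext
  apply Representation.IntertwiningMap.ext
  apply MonoidAlgebra.lhom_ext'
  intro x
  apply LinearMap.ext_ring
  exact h x

theorem perm_hom_equivariant {X : Type} [MulAction K X] {A : Rep.{0} k K}
    (f : Rep.ofMulAction k K X ⟶ A) (g : K) (x : X) :
    f.hom (pt k K (g • x)) = A.ρ g (f.hom (pt k K x)) := by
  rw [← Rep.hom_comm_apply]
  congr 1
  exact (Representation.ofMulAction_single g x 1).symm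

/-- The morphism of permutation modules induced by an equivariant map. -/
noncomputable def permMap {X Y : Type} [MulAction K X] [MulAction K Y] (φ : X → Y)
    (hφ : ∀ (g : K) (x : X), φ (g • x) = g • φ x) :
    Rep.ofMulAction k K X ⟶ Rep.ofMulAction k K Y :=
  permLift (Rep.ofMulAction k K Y) (fun x => (pt k K (φ x))) (by
    intro g x
    rw [hφ]
    exact (Representation.ofMulAction_single g (φ x) 1).symm)

theorem permMap_single {X Y : Type} [MulAction K X] [MulAction K Y] (φ : X → Y)
    (hφ : ∀ (g : K) (x : X), φ (g • x) = g • φ x) (x : X) :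
    (permMap φ hφ).hom (pt k K x) = (pt k K (φ x)) :=
  permLift_single _ _ _ x

theorem comp_single {X : Type} [MulAction K X] {A B : Rep.{0} k K}
    (f : Rep.ofMulAction k K X ⟶ A) (g : A ⟶ B) (x : X) :
    (f ≫ g).hom (pt k K x) = g.hom (f.hom (pt k K x)) := rfl

theorem permMap_comp_single {X Y : Type} [MulAction K X] [MulAction K Y] (φ : X → Y)
    (hφ : ∀ (g : K) (x : X), φ (g • x) = g • φ x) {A : Rep.{0} k K}
    (f : Rep.ofMulAction k K Y ⟶ A) (x : X) :
    (permMap φ hφ ≫ f).hom (pt k K x)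
      = f.hom (pt k K (φ x)) := by
  rw [comp_single, permMap_single]

/-- Equivalent `K`-sets have isomorphic permutation modules. -/
theorem perm_iso_of_bijective {X Y : Type} [MulAction K X] [MulAction K Y] (φ : X → Y)
    (hφ : ∀ (g : K) (x : X), φ (g • x) = g • φ x) (hb : Function.Bijective φ) :
    Nonempty (Rep.ofMulAction k K X ≅ Rep.ofMulAction k K Y) := by
  let e := Equiv.ofBijective φ hb
  have he : ∀ y, φ (e.symm y) = y := fun y => e.apply_symm_apply y
  have he' : ∀ x, e.symm (φ x) = x := fun x => e.symm_apply_apply x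
  refine ⟨⟨permMap φ hφ, permMap e.symm ?_, ?_, ?_⟩⟩
  · intro g y
    apply hb.1
    rw [he, hφ, he]
  · apply perm_hom_ext
    intro x
    rw [permMap_comp_single, permMap_single, he']
    rfl
  · apply perm_hom_ext
    intro x
    rw [permMap_comp_single, permMap_single, he]
    rfl

theorem perm_sum_iso (X Y : Type) [MulAction K X] [MulAction K Y] :
    Nonempty (Rep.ofMulAction k K (X ⊕ Y) ≅ Rep.ofMulAction k K X ⊞ Rep.ofMulAction k K Y) := by
  let c : BinaryCofan (Rep.ofMulAction k K X) (Rep.ofMulAction k K Y) :=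
    BinaryCofan.mk (permMap (Sum.inl : X → X ⊕ Y) (fun _ _ => rfl))
      (permMap (Sum.inr : Y → X ⊕ Y) (fun _ _ => rfl))
  have hc : IsColimit c := by
    refine BinaryCofan.IsColimit.mk c
      (fun {T} f g => permLift T (Sum.elim (fun x => f.hom (pt k K x))
        (fun x => g.hom (pt k K x))) ?_) ?_ ?_ ?_
    · rintro k (x | x)
      · exact perm_hom_equivariant f k x
      · exact perm_hom_equivariant g k x
    · intro T f g
      apply perm_hom_ext
      intro x
      refine (permMap_comp_single _ (fun _ _ => rfl) _ x).trans ?_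
      rw [permLift_single]
      rfl
    · intro T f g
      apply perm_hom_ext
      intro x
      refine (permMap_comp_single _ (fun _ _ => rfl) _ x).trans ?_
      rw [permLift_single]
      rfl
    · intro T f g m hf hg
      apply perm_hom_ext
      rintro (x | x)
      · rw [permLift_single, ← hf]
        exact (permMap_comp_single _ (fun _ _ => rfl) _ x).symm
      · rw [permLift_single, ← hg]
        exact (permMap_comp_single _ (fun _ _ => rfl) _ x).symm
  exact ⟨hc.coconePointUniqueUpToIso (BinaryBiproduct.isColimit _ _)⟩

theorem perm_sigma_iso {n : ℕ} (X : Fin n → Type) [∀ i, MulAction K (X i)] :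
    Nonempty (Rep.ofMulAction k K (Σ i, X i) ≅ ⨁ fun i => Rep.ofMulAction k K (X i)) := by
  let c : Cofan (fun i => Rep.ofMulAction k K (X i)) :=
    Cofan.mk (Rep.ofMulAction k K (Σ i, X i))
      (fun i => permMap (fun x => (⟨i, x⟩ : Σ i, X i)) (fun _ _ => rfl))
  have hc : IsColimit c := by
    refine Cofan.IsColimit.mk c
      (fun s => permLift s.pt (fun x => (s.inj x.1).hom (pt k K x.2)) ?_)
      ?_ ?_
    · rintro k ⟨i, x⟩
      exact perm_hom_equivariant (s.inj i) k x
    · intro s i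
      apply perm_hom_ext
      intro x
      refine (permMap_comp_single _ (fun _ _ => rfl) _ x).trans ?_
      rw [permLift_single]
    · intro s m hm
      apply perm_hom_ext
      rintro ⟨i, x⟩
      rw [permLift_single, ← hm]
      exact (permMap_comp_single _ (fun _ _ => rfl) _ x).symm
  exact ⟨hc.coconePointUniqueUpToIso (biproduct.isColimit _)⟩

end RepLemmas
section OrbitLemmas

variable {K : Type} [Group K] {X : Type} [MulAction K X]

/-- The orbit map `K/H → X`, where `H` is the stabilizer of `x`. -/
def orbMap (x : X) (H : Subgroup K) (hH : MulAction.stabilizer K x = H) : K ⧸ H → X :=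
  Quotient.lift (fun g : K => g • x) (by
    intro a b hab
    have h1 : a⁻¹ * b ∈ H := QuotientGroup.leftRel_apply.mp hab
    rw [← hH, MulAction.mem_stabilizer_iff, mul_smul, inv_smul_eq_iff] at h1
    exact h1.symm)

theorem orbMap_mk (x : X) (H : Subgroup K) (hH : MulAction.stabilizer K x = H) (g : K) :
    orbMap x H hH (QuotientGroup.mk g) = g • x := rfl

theorem orbMap_smul (x : X) (H : Subgroup K) (hH : MulAction.stabilizer K x = H) (g : K)
    (q : K ⧸ H) : orbMap x H hH (g • q) = g • orbMap x H hH q := by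
  induction q using QuotientGroup.induction_on with
  | H a =>
    change (g * a) • x = g • a • x
    exact mul_smul g a x

theorem orbMap_injective (x : X) (H : Subgroup K) (hH : MulAction.stabilizer K x = H) :
    Function.Injective (orbMap x H hH) := by
  intro q r h
  induction q using QuotientGroup.induction_on with
  | H a =>
    induction r using QuotientGroup.induction_on with
    | H b =>
      rw [orbMap_mk, orbMap_mk] at h
      apply QuotientGroup.eq.mpr
      rw [← hH, MulAction.mem_stabilizer_iff, mul_smul, inv_smul_eq_iff]
      exact h.symm

theorem orbMap_mem_orbit (x : X) (H : Subgroup K) (hH : MulAction.stabilizer K x = H)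
    (q : K ⧸ H) : orbMap x H hH q ∈ MulAction.orbit K x := by
  induction q using QuotientGroup.induction_on with
  | H a => exact ⟨a, rfl⟩

theorem exists_orbMap (x : X) (H : Subgroup K) (hH : MulAction.stabilizer K x = H)
    (y : X) (hy : y ∈ MulAction.orbit K x) : ∃ q, orbMap x H hH q = y := by
  obtain ⟨a, rfl⟩ := hy
  exact ⟨QuotientGroup.mk a, rfl⟩

/-- If all stabilizers are equal to `H`, then `X` is a disjoint union of copies of `K/H`. -/
theorem exists_sigma_bijection [Finite K] [Finite X] (H : Subgroup K)
    (hH : ∀ x : X, MulAction.stabilizer K x = H) (n : ℕ)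
    (hn : Nat.card X = n * Nat.card (K ⧸ H)) :
    ∃ φ : (Σ _ : Fin n, K ⧸ H) → X, (∀ (g : K) s, φ (g • s) = g • φ s) ∧
      Function.Bijective φ := by
  classical
  let Ω := MulAction.orbitRel.Quotient K X
  let ψ : (Σ _ : Ω, K ⧸ H) → X := fun s => orbMap (Quotient.out s.1 : X) H (hH _) s.2
  have horb : ∀ ω : Ω, ∀ x : X, x ∈ MulAction.orbit K (Quotient.out ω : X) →
      (Quotient.mk _ x : Ω) = ω := by
    intro ω x hx
    conv_rhs => rw [← Quotient.out_eq ω]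
    exact Quotient.sound hx
  have hψ : Function.Bijective ψ := by
    constructor
    · rintro ⟨ω, q⟩ ⟨ω', q'⟩ h
      have h1 := horb ω _ (orbMap_mem_orbit (Quotient.out ω : X) H (hH _) q)
      have h2 := horb ω' _ (orbMap_mem_orbit (Quotient.out ω' : X) H (hH _) q')
      have h3 : orbMap (Quotient.out ω : X) H (hH _) q =
        orbMap (Quotient.out ω' : X) H (hH _) q' := h
      have h4 : ω = ω' := by rw [← h1, ← h2, h3]
      subst h4
      rw [orbMap_injective _ _ _ h3]
    · intro x
      have hx : x ∈ MulAction.orbit K (Quotient.out (Quotient.mk _ x : Ω) : X) := by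
        have : (Quotient.mk _ x : Ω) = Quotient.mk _ (Quotient.out (Quotient.mk _ x : Ω) : X) :=
          (Quotient.out_eq _).symm
        exact Quotient.exact this
      obtain ⟨q, hq⟩ := exists_orbMap _ H (hH _) x hx
      exact ⟨⟨_, q⟩, hq⟩
  have hfin : Finite Ω := inferInstance
  have hcard : Nat.card Ω = n := by
    have h1 := Nat.card_congr (Equiv.ofBijective ψ hψ)
    rw [Nat.card_congr (Equiv.sigmaEquivProd Ω (K ⧸ H)), Nat.card_prod, hn] at h1
    exact Nat.eq_of_mul_eq_mul_right Nat.card_pos h1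
  let e : Fin n ≃ Ω := (Finite.equivFinOfCardEq hcard).symm
  let e' : (Σ _ : Fin n, K ⧸ H) ≃ (Σ _ : Ω, K ⧸ H) :=
    Equiv.sigmaCongrLeft (β := fun _ : Ω => K ⧸ H) e
  refine ⟨ψ ∘ e', ?_, hψ.comp e'.bijective⟩
  rintro g ⟨i, q⟩
  exact orbMap_smul (Quotient.out (e i) : X) H (hH _) g q

/-- The complement of two orbits. -/
def twoOrbitCompl (o₁ o₂ : X) : SubMulAction K X where
  carrier := {x | x ∉ MulAction.orbit K o₁ ∧ x ∉ MulAction.orbit K o₂}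
  smul_mem' := by
    rintro g x ⟨h1, h2⟩
    have key : ∀ o : X, g • x ∈ MulAction.orbit K o → x ∈ MulAction.orbit K o := by
      rintro o ⟨a, ha⟩
      refine ⟨g⁻¹ * a, ?_⟩
      change (g⁻¹ * a) • o = x
      rw [mul_smul, inv_smul_eq_iff]
      exact ha
    exact ⟨fun h => h1 (key _ h), fun h => h2 (key _ h)⟩

theorem exists_sum_bijection (o₁ o₂ : X) (H₁ H₂ : Subgroup K)
    (h₁ : MulAction.stabilizer K o₁ = H₁) (h₂ : MulAction.stabilizer K o₂ = H₂)
    (hne : o₂ ∉ MulAction.orbit K o₁) :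
    ∃ φ : (K ⧸ H₁) ⊕ ((K ⧸ H₂) ⊕ (twoOrbitCompl (K := K) o₁ o₂)) → X,
      (∀ (g : K) s, φ (g • s) = g • φ s) ∧ Function.Bijective φ := by
  have hdis : ∀ x, x ∈ MulAction.orbit K o₁ → x ∈ MulAction.orbit K o₂ → False := by
    rintro x ⟨a, rfl⟩ ⟨b, hb⟩
    apply hne
    refine ⟨b⁻¹ * a, ?_⟩
    change (b⁻¹ * a) • o₁ = o₂
    rw [mul_smul, inv_smul_eq_iff]
    exact hb.symm
  refine ⟨Sum.elim (orbMap o₁ H₁ h₁) (Sum.elim (orbMap o₂ H₂ h₂) (fun y => (y : X))), ?_, ?_, ?_⟩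
  · rintro g (q | q | y)
    · exact orbMap_smul _ _ h₁ g q
    · exact orbMap_smul _ _ h₂ g q
    · rfl
  · rintro (q | q | y) (q' | q' | y') h
    · exact congrArg _ (orbMap_injective _ _ h₁ h)
    · exact (hdis _ (orbMap_mem_orbit _ _ h₁ q) (by
        have := orbMap_mem_orbit _ _ h₂ q'
        rwa [← show orbMap o₁ H₁ h₁ q = orbMap o₂ H₂ h₂ q' from h] at this)).elim
    · exact (y'.2.1 (by
        have := orbMap_mem_orbit _ _ h₁ q
        rwa [show orbMap o₁ H₁ h₁ q = (y' : X) from h] at this)).elim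
    · exact (hdis _ (orbMap_mem_orbit _ _ h₁ q') (by
        have := orbMap_mem_orbit _ _ h₂ q
        rwa [show orbMap o₂ H₂ h₂ q = orbMap o₁ H₁ h₁ q' from h] at this)).elim
    · exact congrArg (fun t => Sum.inr (Sum.inl t)) (orbMap_injective _ _ h₂ h)
    · exact (y'.2.2 (by
        have := orbMap_mem_orbit _ _ h₂ q
        rwa [show orbMap o₂ H₂ h₂ q = (y' : X) from h] at this)).elim
    · exact (y.2.1 (by
        have := orbMap_mem_orbit _ _ h₁ q'
        rwa [← show (y : X) = orbMap o₁ H₁ h₁ q' from h] at this)).elim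
    · exact (y.2.2 (by
        have := orbMap_mem_orbit _ _ h₂ q'
        rwa [← show (y : X) = orbMap o₂ H₂ h₂ q' from h] at this)).elim
    · exact congrArg (fun t => Sum.inr (Sum.inr t)) (Subtype.ext h)
  · intro x
    by_cases hx1 : x ∈ MulAction.orbit K o₁
    · obtain ⟨q, hq⟩ := exists_orbMap _ H₁ h₁ x hx1
      exact ⟨Sum.inl q, hq⟩
    by_cases hx2 : x ∈ MulAction.orbit K o₂
    · obtain ⟨q, hq⟩ := exists_orbMap _ H₂ h₂ x hx2
      exact ⟨Sum.inr (Sum.inl q), hq⟩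
    exact ⟨Sum.inr (Sum.inr ⟨x, hx1, hx2⟩), rfl⟩

end OrbitLemmas
section Matrices

open Matrix

theorem mem_BorelSL2 (g : SpecialLinearGroup (Fin 2) (ZMod p)) :
    g ∈ BorelSL2 p ↔ g.1 1 0 = 0 := Iff.rfl

theorem sl_coe_mul (g h : SpecialLinearGroup (Fin 2) (ZMod p)) : (g * h).1 = g.1 * h.1 := rfl

theorem sl_coe_one : (1 : SpecialLinearGroup (Fin 2) (ZMod p)).1 = 1 := rfl

theorem unip_10 (x : ZMod p) : (unip p x).1 1 0 = x := rfl

theorem unip_11 (x : ZMod p) : (unip p x).1 1 1 = 1 := rfl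

theorem sl_mul_10 (g h : SpecialLinearGroup (Fin 2) (ZMod p)) :
    (g * h).1 1 0 = g.1 1 0 * h.1 0 0 + g.1 1 1 * h.1 1 0 := by
  rw [sl_coe_mul, Matrix.mul_apply, Fin.sum_univ_two]

theorem sl_mul_inv_10 (g h : SpecialLinearGroup (Fin 2) (ZMod p)) :
    (g * h⁻¹).1 1 0 = g.1 1 0 * h.1 1 1 - g.1 1 1 * h.1 1 0 := by
  rw [sl_mul_10, SpecialLinearGroup.SL2_inv_expl]
  simp [sub_eq_add_neg]

/-- The lower left entry of a conjugate. -/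
theorem sl_conj_10 (g m : SpecialLinearGroup (Fin 2) (ZMod p)) :
    (g * m * g⁻¹).1 1 0 = (g.1 1 0 * m.1 0 0 + g.1 1 1 * m.1 1 0) * g.1 1 1
      - (g.1 1 0 * m.1 0 1 + g.1 1 1 * m.1 1 1) * g.1 1 0 := by
  rw [sl_mul_inv_10, sl_mul_10, sl_coe_mul, Matrix.mul_apply, Fin.sum_univ_two]

theorem sl_det (g : SpecialLinearGroup (Fin 2) (ZMod p)) :
    g.1 0 0 * g.1 1 1 - g.1 0 1 * g.1 1 0 = 1 := by
  have := g.2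
  rwa [Matrix.det_fin_two] at this

theorem a6_sq : (a6 p) ^ 2 = ⟨!![-1, -1; 1, 0], by simp [Matrix.det_fin_two_of]⟩ := by
  apply Subtype.ext
  rw [pow_two, sl_coe_mul]
  simp [a6]

theorem a6_cube : (a6 p) ^ 3 = a2 p := by
  apply Subtype.ext
  rw [pow_succ, sl_coe_mul, a6_sq]
  simp [a6, a2]

theorem a2_mul_self : a2 p * a2 p = 1 := by
  apply Subtype.ext
  rw [sl_coe_mul, sl_coe_one]
  simp [a2, Matrix.one_fin_two]

theorem a6_pow_six : (a6 p) ^ 6 = 1 := by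
  rw [show 6 = 3 * 2 by rfl, pow_mul, a6_cube, pow_two, a2_mul_self]

theorem a2_comm (g : SpecialLinearGroup (Fin 2) (ZMod p)) : g * a2 p = a2 p * g := by
  apply Subtype.ext
  rw [sl_coe_mul, sl_coe_mul]
  ext i j
  fin_cases i <;> fin_cases j <;> simp [a2, Matrix.mul_apply]

theorem a2_mem_a6 : a2 p ∈ Subgroup.zpowers (a6 p) := by
  rw [← a6_cube]
  exact Subgroup.pow_mem _ (Subgroup.mem_zpowers _) 3

theorem a2_mem_Borel : a2 p ∈ BorelSL2 p := by
  rw [mem_BorelSL2]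
  simp [a2]

/-- Each element of `C₆` is `u + v a₆`, and either lies in `C₂` or `v = ± 1`. -/
theorem C6_elem (m : SpecialLinearGroup (Fin 2) (ZMod p)) (hm : m ∈ Subgroup.zpowers (a6 p)) :
    ∃ v : ZMod p, m.1 1 0 = v ∧ m.1 0 1 = -v ∧ m.1 1 1 = m.1 0 0 + v ∧
      (m ∈ Subgroup.zpowers (a2 p) ∨ v = 1 ∨ v = -1) := by
  have hfin : IsOfFinOrder (a6 p) := isOfFinOrder_iff_pow_eq_one.mpr ⟨6, by norm_num, a6_pow_six p⟩
  have base : ∃ k : ℕ, k < 6 ∧ (a6 p) ^ k = m := by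
    obtain ⟨k, rfl⟩ := (hfin.mem_powers_iff_mem_zpowers).mpr hm
    exact ⟨k % 6, Nat.mod_lt _ (by norm_num), (pow_eq_pow_mod k (a6_pow_six p)).symm⟩
  obtain ⟨k, hk, rfl⟩ := base
  interval_cases k
  · exact ⟨0, by simp, by simp, by simp, Or.inl (by rw [pow_zero]; exact Subgroup.one_mem _)⟩
  · rw [pow_one]
    exact ⟨1, by simp [a6], by simp [a6], by simp [a6], by simp⟩
  · rw [a6_sq]
    exact ⟨1, by simp, by simp, by simp, by simp⟩
  · rw [a6_cube]
    exact ⟨0, by simp [a2], by simp [a2], by simp [a2], Or.inl (Subgroup.mem_zpowers _)⟩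
  · have : (a6 p) ^ 4 = ⟨!![0, 1; -1, -1], by simp [Matrix.det_fin_two_of]⟩ := by
      apply Subtype.ext
      rw [pow_succ, a6_cube, sl_coe_mul]
      simp [a6, a2]
    rw [this]
    exact ⟨-1, by simp, by simp, by simp, by simp⟩
  · have : (a6 p) ^ 5 = ⟨!![1, 1; -1, 0], by simp [Matrix.det_fin_two_of]⟩ := by
      apply Subtype.ext
      rw [show 5 = 3 + 2 by rfl, pow_add, sl_coe_mul, a6_cube, a6_sq]
      simp [a2]
    rw [this]
    exact ⟨-1, by simp, by simp, by simp, by simp⟩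

/-- The quadratic form controlling which conjugates of `C₆` lie in the Borel subgroup. -/
def Q (g : SpecialLinearGroup (Fin 2) (ZMod p)) : ZMod p :=
  g.1 1 0 ^ 2 - g.1 1 0 * g.1 1 1 + g.1 1 1 ^ 2

theorem conj_C6_10 (g m : SpecialLinearGroup (Fin 2) (ZMod p)) (v : ZMod p)
    (h1 : m.1 1 0 = v) (h2 : m.1 0 1 = -v) (h3 : m.1 1 1 = m.1 0 0 + v) :
    (g * m * g⁻¹).1 1 0 = v * Q p g := by
  rw [sl_conj_10, h1, h2, h3, Q]
  ring

theorem conj_le_Borel (g : SpecialLinearGroup (Fin 2) (ZMod p)) (hg : Q p g = 0) :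
    Subgroup.map (MulAut.conj g).toMonoidHom (Subgroup.zpowers (a6 p)) ≤ BorelSL2 p := by
  rintro _ ⟨m, hm, rfl⟩
  obtain ⟨v, h1, h2, h3, -⟩ := C6_elem p m hm
  change (g * m * g⁻¹).1 1 0 = 0
  rw [conj_C6_10 p g m v h1 h2 h3, hg, mul_zero]

theorem Q_unip (x : ZMod p) : Q p (unip p x) = x ^ 2 - x + 1 := by
  simp [Q, unip]

/-- Stabilizers of cosets. -/
theorem stab_eq (g : SpecialLinearGroup (Fin 2) (ZMod p)) :
    MulAction.stabilizer (BorelSL2 p)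
      (QuotientGroup.mk g : SpecialLinearGroup (Fin 2) (ZMod p) ⧸ Subgroup.zpowers (a6 p)) =
    ((Subgroup.map (MulAut.conj g).toMonoidHom (Subgroup.zpowers (a6 p)) ⊓
              BorelSL2 p).subgroupOf (BorelSL2 p)) := by
  ext b
  rw [MulAction.mem_stabilizer_iff, Subgroup.mem_subgroupOf, Subgroup.mem_inf]
  have h1 : b • (QuotientGroup.mk g : SpecialLinearGroup (Fin 2) (ZMod p) ⧸
      Subgroup.zpowers (a6 p)) = QuotientGroup.mk ((b : SpecialLinearGroup (Fin 2) (ZMod p)) * g) :=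
    rfl
  rw [h1, eq_comm, QuotientGroup.eq]
  constructor
  · intro h
    refine ⟨⟨_, h, ?_⟩, b.2⟩
    change g * (g⁻¹ * (↑b * g)) * g⁻¹ = ↑b
    group
  · rintro ⟨⟨m, hm, hmb⟩, -⟩
    have h2 : g * m * g⁻¹ = ↑b := hmb
    rw [← h2]
    have h3 : g⁻¹ * (g * m * g⁻¹ * g) = m := by group
    rw [h3]
    exact hm

theorem stab_eq_C2 [Fact p.Prime] (g : SpecialLinearGroup (Fin 2) (ZMod p)) (hg : Q p g ≠ 0) :
    MulAction.stabilizer (BorelSL2 p)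
      (QuotientGroup.mk g : SpecialLinearGroup (Fin 2) (ZMod p) ⧸ Subgroup.zpowers (a6 p)) =
    (Subgroup.zpowers (a2 p)).subgroupOf (BorelSL2 p) := by
  rw [stab_eq]
  ext b
  rw [Subgroup.mem_subgroupOf, Subgroup.mem_inf, Subgroup.mem_subgroupOf]
  have hcomm : ∀ m ∈ Subgroup.zpowers (a2 p), g * m * g⁻¹ = m := by
    rintro m ⟨k, rfl⟩
    have : Commute g (a2 p) := a2_comm p g
    change g * (a2 p) ^ k * g⁻¹ = (a2 p) ^ k
    rw [(this.zpow_right k).eq, mul_inv_cancel_right]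
  constructor
  · rintro ⟨⟨m, hm, hmb⟩, hb⟩
    have h2 : g * m * g⁻¹ = ↑b := hmb
    obtain ⟨v, e1, e2, e3, e4⟩ := C6_elem p m hm
    have h0 : v * Q p g = 0 := by
      rw [← conj_C6_10 p g m v e1 e2 e3, h2]
      exact hb
    rcases e4 with e4 | rfl | rfl
    · rw [← h2, hcomm m e4]
      exact e4
    · exact absurd (by simpa using h0) hg
    · exact absurd (by simpa using h0) hg
  · intro hb
    refine ⟨⟨b, ?_, hcomm _ hb⟩, b.2⟩
    exact (Subgroup.zpowers_le.mpr (a2_mem_a6 p)) hb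

theorem mem_unip_coset [Fact p.Prime] (g : SpecialLinearGroup (Fin 2) (ZMod p))
    (hg : g.1 1 1 ≠ 0) : g * (unip p (g.1 1 0 / g.1 1 1))⁻¹ ∈ BorelSL2 p := by
  rw [mem_BorelSL2, sl_mul_inv_10]
  simp only [unip]
  simp
  field_simp
  ring

/-- Bruhat-type count: `|G| = (p+1)|B|`. -/
theorem card_G [Fact p.Prime] : Nat.card (SpecialLinearGroup (Fin 2) (ZMod p)) =
    (p + 1) * Nat.card (BorelSL2 p) := by
  let w : SpecialLinearGroup (Fin 2) (ZMod p) := ⟨!![0, -1; 1, 0], by simp [Matrix.det_fin_two_of]⟩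
  let r : Option (ZMod p) → SpecialLinearGroup (Fin 2) (ZMod p) := fun o => o.elim w (unip p)
  let f : Option (ZMod p) × BorelSL2 p → SpecialLinearGroup (Fin 2) (ZMod p) :=
    fun s => s.2.1 * r s.1
  have hr : ∀ o o', r o * (r o')⁻¹ ∈ BorelSL2 p → o = o' := by
    intro o o' h
    rw [mem_BorelSL2, sl_mul_inv_10] at h
    rcases o with _ | x <;> rcases o' with _ | y
    · rfl
    · rw [show (r none).1 1 0 = 1 from rfl, show (r none).1 1 1 = 0 from rfl,
        show (r (some y)).1 1 1 = 1 from rfl] at h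
      simp at h
    · rw [show (r none).1 1 0 = 1 from rfl, show (r none).1 1 1 = 0 from rfl,
        show (r (some x)).1 1 1 = 1 from rfl] at h
      simp at h
    · rw [show (r (some x)).1 1 0 = x from rfl, show (r (some x)).1 1 1 = 1 from rfl,
        show (r (some y)).1 1 0 = y from rfl, show (r (some y)).1 1 1 = 1 from rfl] at h
      congr 1
      linear_combination h
  have hf : Function.Bijective f := by
    constructor
    · rintro ⟨o, b⟩ ⟨o', b'⟩ h
      have h1 : b.1 * r o = b'.1 * r o' := h
      have h2 : r o * (r o')⁻¹ = b.1⁻¹ * b'.1 := by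
        rw [mul_inv_eq_iff_eq_mul, mul_assoc, ← h1, inv_mul_cancel_left]
      have h3 : o = o' := hr o o' (by
        rw [h2]
        exact Subgroup.mul_mem _ (Subgroup.inv_mem _ b.2) b'.2)
      subst h3
      have h4 : b = b' := Subtype.ext (mul_right_cancel h1)
      rw [h4]
    · intro g
      by_cases hg : g.1 1 1 = 0
      · refine ⟨⟨none, ⟨g * w⁻¹, ?_⟩⟩, ?_⟩
        · rw [mem_BorelSL2, sl_mul_inv_10]
          simp [w, hg]
        · change g * w⁻¹ * w = g
          group
      · refine ⟨⟨some (g.1 1 0 / g.1 1 1), ⟨_, mem_unip_coset p g hg⟩⟩, ?_⟩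
        change g * (unip p (g.1 1 0 / g.1 1 1))⁻¹ * unip p (g.1 1 0 / g.1 1 1) = g
        group
  rw [← Nat.card_congr (Equiv.ofBijective f hf), Nat.card_prod, Finite.card_option, Nat.card_zmod]

theorem two_ne [Fact p.Prime] (hp3 : 3 < p) : (2 : ZMod p) ≠ 0 := by
  intro h
  have h1 : ((2 : ℕ) : ZMod p) = 0 := by exact_mod_cast h
  rw [ZMod.natCast_eq_zero_iff] at h1
  have := Nat.le_of_dvd (by norm_num) h1
  omega

theorem three_ne [Fact p.Prime] (hp3 : 3 < p) : (3 : ZMod p) ≠ 0 := by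
  intro h
  have h1 : ((3 : ℕ) : ZMod p) = 0 := by exact_mod_cast h
  rw [ZMod.natCast_eq_zero_iff] at h1
  have := Nat.le_of_dvd (by norm_num) h1
  omega

theorem a2_ne_one [Fact p.Prime] (hp3 : 3 < p) : a2 p ≠ 1 := by
  intro h
  have h1 : (a2 p).1 0 0 = (1 : SpecialLinearGroup (Fin 2) (ZMod p)).1 0 0 := by rw [h]
  have h2 : (-1 : ZMod p) = 1 := by simpa [a2] using h1
  apply two_ne p hp3
  linear_combination -h2

theorem card_C2 [Fact p.Prime] (hp3 : 3 < p) : Nat.card (Subgroup.zpowers (a2 p)) = 2 := by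
  rw [Nat.card_zpowers]
  exact orderOf_eq_prime (by rw [pow_two, a2_mul_self]) (a2_ne_one p hp3)

theorem card_C6 [Fact p.Prime] (hp3 : 3 < p) : Nat.card (Subgroup.zpowers (a6 p)) = 6 := by
  rw [Nat.card_zpowers]
  refine orderOf_eq_of_pow_and_pow_div_prime (by norm_num) (a6_pow_six p) ?_
  intro q hq hq6
  have hq' : q = 2 ∨ q = 3 := by
    have := Nat.le_of_dvd (by norm_num) hq6
    interval_cases q <;> revert hq hq6 <;> decide
  rcases hq' with rfl | rfl
  · rw [show 6 / 2 = 3 by rfl, a6_cube]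
    exact a2_ne_one p hp3
  · rw [show 6 / 3 = 2 by rfl, a6_sq]
    intro h
    have h1 := congrArg (fun m : SpecialLinearGroup (Fin 2) (ZMod p) => m.1 1 0) h
    simp at h1

theorem card_quot_C2 [Fact p.Prime] (hp3 : 3 < p) :
    Nat.card (BorelSL2 p) =
      Nat.card (BorelSL2 p ⧸ (Subgroup.zpowers (a2 p)).subgroupOf (BorelSL2 p)) * 2 := by
  rw [Subgroup.card_eq_card_quotient_mul_card_subgroup
    ((Subgroup.zpowers (a2 p)).subgroupOf (BorelSL2 p))]
  congr 1
  rw [Nat.card_congr (Subgroup.subgroupOfEquivOfLe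
    (Subgroup.zpowers_le.mpr (a2_mem_Borel p))).toEquiv, card_C2 p hp3]

theorem card_quot_C6 [Fact p.Prime] (hp3 : 3 < p) :
    Nat.card (SpecialLinearGroup (Fin 2) (ZMod p)) =
      Nat.card (SpecialLinearGroup (Fin 2) (ZMod p) ⧸ Subgroup.zpowers (a6 p)) * 6 := by
  rw [Subgroup.card_eq_card_quotient_mul_card_subgroup (Subgroup.zpowers (a6 p)), card_C6 p hp3]

theorem card_quot_conj [Fact p.Prime] (hp3 : 3 < p) (g : SpecialLinearGroup (Fin 2) (ZMod p))
    (hg : Q p g = 0) :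
    Nat.card (BorelSL2 p) = Nat.card (BorelSL2 p ⧸
      ((Subgroup.map (MulAut.conj g).toMonoidHom (Subgroup.zpowers (a6 p)) ⊓
              BorelSL2 p).subgroupOf (BorelSL2 p))) * 6 := by
  rw [Subgroup.card_eq_card_quotient_mul_card_subgroup
    ((Subgroup.map (MulAut.conj g).toMonoidHom (Subgroup.zpowers (a6 p)) ⊓
              BorelSL2 p).subgroupOf (BorelSL2 p))]
  congr 1
  rw [Nat.card_congr (Subgroup.subgroupOfEquivOfLe inf_le_right).toEquiv,
    inf_eq_left.mpr (conj_le_Borel p g hg),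
    ← Nat.card_congr ((Subgroup.zpowers (a6 p)).equivMapOfInjective
      (MulAut.conj g).toMonoidHom (MulAut.conj g).injective).toEquiv, card_C6 p hp3]

theorem Q_zero [Fact p.Prime] (g : SpecialLinearGroup (Fin 2) (ZMod p)) (hg : Q p g = 0) :
    g.1 1 1 ≠ 0 ∧ (g.1 1 0 / g.1 1 1) ^ 2 - g.1 1 0 / g.1 1 1 + 1 = 0 := by
  have hd : g.1 1 1 ≠ 0 := by
    intro hd
    have hdet := sl_det p g
    simp only [Q, hd] at hg
    have hc : g.1 1 0 = 0 := by simpa using hg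
    rw [hd, hc] at hdet
    simp at hdet
  refine ⟨hd, ?_⟩
  simp only [Q] at hg
  field_simp
  linear_combination hg

theorem no_root [Fact p.Prime] (hp3 : 3 < p) (h : p % 3 ≠ 1) (x : ZMod p) :
    x ^ 2 - x + 1 ≠ 0 := by
  intro hx
  have h3 : (-x) ^ 3 = 1 := by linear_combination (-x - 1) * hx
  have h1 : -x ≠ 1 := by
    intro h1
    apply three_ne p hp3
    have : x = -1 := by linear_combination -h1
    rw [this] at hx
    linear_combination hx
  have h0 : -x ≠ 0 := by
    intro h0
    rw [h0] at h3
    simp at h3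
  have ho : orderOf (-x) = 3 := orderOf_eq_prime h3 h1
  have hd : 3 ∣ p - 1 := by
    rw [← ho]
    exact orderOf_dvd_of_pow_eq_one (ZMod.pow_card_sub_one_eq_one h0)
  omega

theorem roots_exist [Fact p.Prime] (hp3 : 3 < p) (h : p % 3 = 1) :
    ∃ x₁ x₂ : ZMod p, x₁ ≠ x₂ ∧ x₁ ^ 2 - x₁ + 1 = 0 ∧ x₂ ^ 2 - x₂ + 1 = 0 := by
  have hd : 3 ∣ Nat.card (ZMod p)ˣ := by
    rw [Nat.card_eq_fintype_card, ZMod.card_units]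
    omega
  obtain ⟨u, hu⟩ := exists_prime_orderOf_dvd_card' 3 hd
  have hu3 : (u : ZMod p) ^ 3 = 1 := by
    have := pow_orderOf_eq_one u
    rw [hu] at this
    rw [← Units.val_pow_eq_pow_val, this, Units.val_one]
  have hu1 : (u : ZMod p) - 1 ≠ 0 := by
    intro h1
    have : u = 1 := Units.ext (by simpa using sub_eq_zero.mp h1)
    rw [this, orderOf_one] at hu
    norm_num at hu
  have hq : (u : ZMod p) ^ 2 + u + 1 = 0 := by
    apply mul_left_cancel₀ hu1
    linear_combination hu3
  refine ⟨-u, 1 + u, ?_, ?_, ?_⟩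
  · intro he
    apply three_ne p hp3
    linear_combination 4 * hq + (2 * (u : ZMod p) + 1) * he
  · linear_combination hq
  · linear_combination hq

theorem root_cases [Fact p.Prime] (x₁ x₂ x : ZMod p) (hne : x₁ ≠ x₂) (h1 : x₁ ^ 2 - x₁ + 1 = 0)
    (h2 : x₂ ^ 2 - x₂ + 1 = 0) (h : x ^ 2 - x + 1 = 0) : x = x₁ ∨ x = x₂ := by
  have hs : x₁ + x₂ - 1 = 0 := by
    apply mul_left_cancel₀ (sub_ne_zero.mpr hne)
    linear_combination h1 - h2
  have : (x - x₁) * (x - x₂) = 0 := by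
    linear_combination h - h1 + (x₁ - x) * hs
  rcases mul_eq_zero.mp this with h | h
  · exact Or.inl (sub_eq_zero.mp h)
  · exact Or.inr (sub_eq_zero.mp h)

end Matrices

/-- The case without fixed points. -/
theorem case_two (hp : p.Prime) (hp3 : 3 < p) (h : p % 3 ≠ 1) :
    Nonempty ((Rep.ofMulAction ℤ (BorelSL2 p)
          (Matrix.SpecialLinearGroup (Fin 2) (ZMod p) ⧸ Subgroup.zpowers (a6 p))) ≅
        (⨁ fun _ : Fin ((p + 1) / 3) => Rep.ofMulAction ℤ (BorelSL2 p)
          ((BorelSL2 p) ⧸ (Subgroup.zpowers (a2 p)).subgroupOf (BorelSL2 p)))) := by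
  haveI : Fact p.Prime := ⟨hp⟩
  have hmod : (p + 1) / 3 * 3 = p + 1 := by
    have : ¬ 3 ∣ p := by
      intro hd
      have := (Nat.prime_dvd_prime_iff_eq Nat.prime_three hp).mp hd
      omega
    omega
  obtain ⟨φ, hφ, hb⟩ := exists_sigma_bijection (K := BorelSL2 p)
    (X := Matrix.SpecialLinearGroup (Fin 2) (ZMod p) ⧸ Subgroup.zpowers (a6 p))
    ((Subgroup.zpowers (a2 p)).subgroupOf (BorelSL2 p)) (by
      intro x
      induction x using QuotientGroup.induction_on with
      | H g =>
        apply stab_eq_C2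
        intro hQ
        exact no_root p hp3 h _ (Q_zero p g hQ).2) ((p + 1) / 3) (by
      have e1 := card_quot_C6 p hp3
      have e2 := card_quot_C2 p hp3
      have e3 := card_G p
      rw [← hmod, e1, e2] at e3
      linarith)
  obtain ⟨i⟩ := perm_iso_of_bijective (k := ℤ) φ hφ hb
  obtain ⟨j⟩ := perm_sigma_iso (k := ℤ) (K := BorelSL2 p) (fun _ : Fin ((p + 1) / 3) =>
    ((BorelSL2 p) ⧸ (Subgroup.zpowers (a2 p)).subgroupOf (BorelSL2 p)))
  exact ⟨i.symm ≪≫ j⟩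

/-- The case with two fixed points. -/
theorem case_one (hp : p.Prime) (hp3 : 3 < p) (h : p % 3 = 1) (x₁ x₂ : ZMod p) (hne : x₁ ≠ x₂)
    (h1 : x₁ ^ 2 - x₁ + 1 = 0) (h2 : x₂ ^ 2 - x₂ + 1 = 0) :
      Nonempty ((Rep.ofMulAction ℤ (BorelSL2 p)
          (Matrix.SpecialLinearGroup (Fin 2) (ZMod p) ⧸ Subgroup.zpowers (a6 p))) ≅
        (Rep.ofMulAction ℤ (BorelSL2 p) ((BorelSL2 p) ⧸
            ((Subgroup.map (MulAut.conj (unip p x₁)).toMonoidHom (Subgroup.zpowers (a6 p)) ⊓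
              BorelSL2 p).subgroupOf (BorelSL2 p))) ⊞
          (Rep.ofMulAction ℤ (BorelSL2 p) ((BorelSL2 p) ⧸
            ((Subgroup.map (MulAut.conj (unip p x₂)).toMonoidHom (Subgroup.zpowers (a6 p)) ⊓
              BorelSL2 p).subgroupOf (BorelSL2 p))) ⊞
            (⨁ fun _ : Fin ((p - 1) / 3) => Rep.ofMulAction ℤ (BorelSL2 p)
              ((BorelSL2 p) ⧸ (Subgroup.zpowers (a2 p)).subgroupOf (BorelSL2 p)))))) := by
  haveI : Fact p.Prime := ⟨hp⟩
  have hmod : (p - 1) / 3 * 3 + 2 = p + 1 := by omega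
  have hQ1 : Q p (unip p x₁) = 0 := by rw [Q_unip, h1]
  have hQ2 : Q p (unip p x₂) = 0 := by rw [Q_unip, h2]
  let C := Subgroup.zpowers (a6 p)
  let X := Matrix.SpecialLinearGroup (Fin 2) (ZMod p) ⧸ C
  let o₁ : X := QuotientGroup.mk (unip p x₁)
  let o₂ : X := QuotientGroup.mk (unip p x₂)
  have hno : o₂ ∉ MulAction.orbit (BorelSL2 p) o₁ := by
    rintro ⟨b, hb⟩
    have hb' : (QuotientGroup.mk (b.1 * unip p x₁) : X) = QuotientGroup.mk (unip p x₂) := hb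
    have hm : (b.1 * unip p x₁)⁻¹ * unip p x₂ ∈ C := QuotientGroup.eq.mp hb'
    have hB := conj_le_Borel p _ hQ1 ⟨_, hm, rfl⟩
    have hB' : unip p x₁ * ((b.1 * unip p x₁)⁻¹ * unip p x₂) * (unip p x₁)⁻¹ ∈ BorelSL2 p := hB
    have e : unip p x₁ * ((b.1 * unip p x₁)⁻¹ * unip p x₂) * (unip p x₁)⁻¹ =
      b.1⁻¹ * (unip p x₂ * (unip p x₁)⁻¹) := by group
    rw [e] at hB'
    have hB2 := (Subgroup.mul_mem_cancel_left _ (Subgroup.inv_mem _ b.2)).mp hB'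
    rw [mem_BorelSL2, sl_mul_inv_10, unip_10, unip_10, unip_11, unip_11] at hB2
    apply hne
    linear_combination -hB2
  obtain ⟨φ, hφ, hb⟩ := exists_sum_bijection (K := BorelSL2 p) o₁ o₂ _ _
    (stab_eq p (unip p x₁)) (stab_eq p (unip p x₂)) hno
  have horb : ∀ g : Matrix.SpecialLinearGroup (Fin 2) (ZMod p), Q p g = 0 →
      (QuotientGroup.mk g : X) ∈ MulAction.orbit (BorelSL2 p) o₁ ∨
      (QuotientGroup.mk g : X) ∈ MulAction.orbit (BorelSL2 p) o₂ := by
    intro g hg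
    obtain ⟨hd, hr⟩ := Q_zero p g hg
    have hm := mem_unip_coset p g hd
    rcases root_cases p x₁ x₂ _ hne h1 h2 hr with hx | hx
    · left
      rw [hx] at hm
      refine ⟨⟨_, hm⟩, ?_⟩
      change (QuotientGroup.mk (g * (unip p x₁)⁻¹ * unip p x₁) : X) = QuotientGroup.mk g
      rw [inv_mul_cancel_right]
    · right
      rw [hx] at hm
      refine ⟨⟨_, hm⟩, ?_⟩
      change (QuotientGroup.mk (g * (unip p x₂)⁻¹ * unip p x₂) : X) = QuotientGroup.mk g
      rw [inv_mul_cancel_right]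
  obtain ⟨ψ, hψ, hbψ⟩ := exists_sigma_bijection (K := BorelSL2 p)
    (X := twoOrbitCompl (K := BorelSL2 p) o₁ o₂)
    ((Subgroup.zpowers (a2 p)).subgroupOf (BorelSL2 p)) (by
      rintro ⟨x, hx⟩
      rw [SubMulAction.stabilizer_of_subMul]
      induction x using QuotientGroup.induction_on with
      | H g =>
        apply stab_eq_C2
        intro hQ
        rcases horb g hQ with h | h
        · exact hx.1 h
        · exact hx.2 h) ((p - 1) / 3) (by
      have e1 := card_quot_C6 p hp3
      have e2 := card_quot_C2 p hp3
      have e3 := card_G p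
      have e4 := card_quot_conj p hp3 _ hQ1
      have e5 := card_quot_conj p hp3 _ hQ2
      have e6 := Nat.card_congr (Equiv.ofBijective φ hb)
      rw [Nat.card_sum, Nat.card_sum] at e6
      rw [← hmod, e1, ← e6, add_mul ((p - 1) / 3 * 3)] at e3
      nlinarith)
  obtain ⟨i⟩ := perm_iso_of_bijective (k := ℤ) φ hφ hb
  obtain ⟨i'⟩ := perm_iso_of_bijective (k := ℤ) ψ hψ hbψ
  obtain ⟨j⟩ := perm_sigma_iso (k := ℤ) (K := BorelSL2 p) (fun _ : Fin ((p - 1) / 3) =>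
    ((BorelSL2 p) ⧸ (Subgroup.zpowers (a2 p)).subgroupOf (BorelSL2 p)))
  obtain ⟨s⟩ := perm_sum_iso (k := ℤ) (K := BorelSL2 p) ((BorelSL2 p) ⧸
            ((Subgroup.map (MulAut.conj (unip p x₁)).toMonoidHom (Subgroup.zpowers (a6 p)) ⊓
              BorelSL2 p).subgroupOf (BorelSL2 p)))
    (((BorelSL2 p) ⧸
            ((Subgroup.map (MulAut.conj (unip p x₂)).toMonoidHom (Subgroup.zpowers (a6 p)) ⊓
              BorelSL2 p).subgroupOf (BorelSL2 p))) ⊕ twoOrbitCompl (K := BorelSL2 p) o₁ o₂)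
  obtain ⟨t⟩ := perm_sum_iso (k := ℤ) (K := BorelSL2 p) ((BorelSL2 p) ⧸
            ((Subgroup.map (MulAut.conj (unip p x₂)).toMonoidHom (Subgroup.zpowers (a6 p)) ⊓
              BorelSL2 p).subgroupOf (BorelSL2 p))) (twoOrbitCompl (K := BorelSL2 p) o₁ o₂)
  exact ⟨i.symm ≪≫ s ≪≫ biprod.mapIso (Iso.refl _)
    (t ≪≫ biprod.mapIso (Iso.refl _) (i'.symm ≪≫ j))⟩

/-- For a prime `p > 3`: if `p ≡ 1 (mod 3)` then the restriction to the Borel subgroup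
`B` of the permutation module `ℤ[G/C₆]`, `G = SL₂(𝔽_p)`, decomposes as
`ℤ[B/(s₁C₆s₁⁻¹ ∩ B)] ⊕ ℤ[B/(s₂C₆s₂⁻¹ ∩ B)] ⊕ ℤ[B/C₂]^{(p-1)/3}`, where
`sᵢ = (1 0; xᵢ 1)` for the two roots `x₁ ≠ x₂` of `t² - t + 1` and `sᵢC₆sᵢ⁻¹ ⊆ B`;
otherwise it is `ℤ[B/C₂]^{(p+1)/3}`. -/
theorem perm_module_GmodC6_restrict_Borel (hp : p.Prime) (hp3 : 3 < p) :
    (p % 3 = 1 → ∃ x₁ x₂ : ZMod p, x₁ ≠ x₂ ∧ x₁ ^ 2 - x₁ + 1 = 0 ∧ x₂ ^ 2 - x₂ + 1 = 0 ∧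
      Subgroup.map (MulAut.conj (unip p x₁)).toMonoidHom (Subgroup.zpowers (a6 p)) ≤
        BorelSL2 p ∧
      Subgroup.map (MulAut.conj (unip p x₂)).toMonoidHom (Subgroup.zpowers (a6 p)) ≤
        BorelSL2 p ∧
      Nonempty ((Rep.ofMulAction ℤ (BorelSL2 p)
          (Matrix.SpecialLinearGroup (Fin 2) (ZMod p) ⧸ Subgroup.zpowers (a6 p))) ≅
        (Rep.ofMulAction ℤ (BorelSL2 p) ((BorelSL2 p) ⧸
            ((Subgroup.map (MulAut.conj (unip p x₁)).toMonoidHom (Subgroup.zpowers (a6 p)) ⊓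
              BorelSL2 p).subgroupOf (BorelSL2 p))) ⊞
          (Rep.ofMulAction ℤ (BorelSL2 p) ((BorelSL2 p) ⧸
            ((Subgroup.map (MulAut.conj (unip p x₂)).toMonoidHom (Subgroup.zpowers (a6 p)) ⊓
              BorelSL2 p).subgroupOf (BorelSL2 p))) ⊞
            (⨁ fun _ : Fin ((p - 1) / 3) => Rep.ofMulAction ℤ (BorelSL2 p)
              ((BorelSL2 p) ⧸ (Subgroup.zpowers (a2 p)).subgroupOf (BorelSL2 p))))))) ∧
    (p % 3 ≠ 1 →
      Nonempty ((Rep.ofMulAction ℤ (BorelSL2 p)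
          (Matrix.SpecialLinearGroup (Fin 2) (ZMod p) ⧸ Subgroup.zpowers (a6 p))) ≅
        (⨁ fun _ : Fin ((p + 1) / 3) => Rep.ofMulAction ℤ (BorelSL2 p)
          ((BorelSL2 p) ⧸ (Subgroup.zpowers (a2 p)).subgroupOf (BorelSL2 p))))) := by
  haveI : Fact p.Prime := ⟨hp⟩
  refine ⟨fun h => ?_, fun h => case_two p hp hp3 h⟩
  obtain ⟨x₁, x₂, hne, h1, h2⟩ := roots_exist p hp3 h
  exact ⟨x₁, x₂, hne, h1, h2, conj_le_Borel p _ (by rw [Q_unip, h1]),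
    conj_le_Borel p _ (by rw [Q_unip, h2]), case_one p hp hp3 h x₁ x₂ hne h1 h2⟩

end AdemNaffah
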